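/- Let B = B(x₀, r) be a ball in ℂⁿ, let u be plurisubharmonic of class C^{1,1} on a neighborhood of the closure of B with det(u_{i j̄}) = f almost everywhere, and let v be plurisubharmonic of class C^{1,1} on B and continuous on the closure of B with det(v_{i j̄}) = f(x₀) almost everywhere in B and v = u on ∂B. Let ω = osc_{B} f = sup_B f − inf_B f be the oscillation of f over B, and assume f ≥ 0. Then sup_{B} |u − v| ≤ r² · ω^{1/n}. In particular, if f is α-Hölder continuous with Hölder constant L, then sup_B |u − v| ≤ L^{1/n} r^{2 + α/n}. -/

import Mathlib

open MeasureTheory Metric Set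
open scoped ComplexOrder

noncomputable section

/-- `ℂⁿ` with its Euclidean (Hermitian) structure. -/
abbrev Cn (n : ℕ) := EuclideanSpace ℂ (Fin n)

instance {n : ℕ} : MeasurableSpace (Cn n) := borel _
instance {n : ℕ} : BorelSpace (Cn n) := ⟨rfl⟩
/-- Lebesgue (Haar) measure on `ℂⁿ`. -/
instance {n : ℕ} : MeasureSpace (Cn n) := ⟨Measure.addHaar⟩

/-- Second derivative of `u` at `z` in the (real) directions `v, w`. -/
def D2 {n : ℕ} (u : Cn n → ℝ) (z v w : Cn n) : ℝ := fderiv ℝ (fderiv ℝ u) z v w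

/-- The complex Hessian matrix `(u_{i j̄})` of a real valued function on `ℂⁿ`:
`u_{i j̄} = (1/4)(u_{x_i x_j} + u_{y_i y_j}) + (i/4)(u_{x_i y_j} - u_{y_i x_j})`. -/
def complexHessian {n : ℕ} (u : Cn n → ℝ) (z : Cn n) : Matrix (Fin n) (Fin n) ℂ := fun i j =>
  (1/4 : ℂ) * ( ((D2 u z (EuclideanSpace.single i 1) (EuclideanSpace.single j 1)
      + D2 u z (EuclideanSpace.single i Complex.I) (EuclideanSpace.single j Complex.I) : ℝ) : ℂ)
    + Complex.I * ((D2 u z (EuclideanSpace.single i 1) (EuclideanSpace.single j Complex.I)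
      - D2 u z (EuclideanSpace.single i Complex.I) (EuclideanSpace.single j 1) : ℝ) : ℂ) )

/-- `u` is of class `C^{1,1}` on the open set `Ω`: continuously differentiable with
locally Lipschitz gradient. -/
def C11On {n : ℕ} (u : Cn n → ℝ) (Ω : Set (Cn n)) : Prop :=
  ContDiffOn ℝ 1 u Ω ∧
    ∀ z ∈ Ω, ∃ ε > 0, ∃ K : NNReal, ball z ε ⊆ Ω ∧ LipschitzOnWith K (fderiv ℝ u) (ball z ε)

/-- The second order derivatives of `u` exist almost everywhere in `Ω`
(automatic for `C^{1,1}` functions, by Rademacher's theorem). -/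
def AESecondDiff {n : ℕ} (u : Cn n → ℝ) (Ω : Set (Cn n)) : Prop :=
  ∀ᵐ z, z ∈ Ω → DifferentiableAt ℝ (fderiv ℝ u) z

/-- A `C^{1,1}` function is plurisubharmonic iff its complex Hessian is positive
semidefinite almost everywhere. -/
def PshAE {n : ℕ} (u : Cn n → ℝ) (Ω : Set (Cn n)) : Prop :=
  ∀ᵐ z, z ∈ Ω → (complexHessian u z).PosSemidef

lemma det_add_smul_one {n : ℕ} {B : Matrix (Fin n) (Fin n) ℂ} (hB : B.IsHermitian) (c : ℝ) :
    (B + (c : ℂ) • (1 : Matrix (Fin n) (Fin n) ℂ)).det = ((∏ i, (hB.eigenvalues i + c) : ℝ) : ℂ) := by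
  have h1 : B.charpoly.eval (-c : ℂ) = (Matrix.scalar (Fin n) (-c : ℂ) - B).det :=
    Matrix.eval_charpoly _ _
  have h2 : Matrix.scalar (Fin n) (-c : ℂ) - B = -(B + (c : ℂ) • (1 : Matrix (Fin n) (Fin n) ℂ)) := by
    ext i j
    by_cases hij : i = j <;> simp [hij]; ring
  rw [h2, Matrix.det_neg, hB.charpoly_eq, Polynomial.eval_prod] at h1
  have h3 : ∏ i, ((Polynomial.X - Polynomial.C ((hB.eigenvalues i : ℝ) : ℂ)).eval (-c : ℂ))
      = (-1) ^ Fintype.card (Fin n) * ((∏ i, (hB.eigenvalues i + c) : ℝ) : ℂ) := by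
    rw [← Finset.card_univ, ← Finset.prod_const, Complex.ofReal_prod, ← Finset.prod_mul_distrib]
    refine Finset.prod_congr rfl fun i _ => ?_
    simp; ring
  exact mul_left_cancel₀ (pow_ne_zero _ (by norm_num)) (h1.symm.trans h3)

lemma det_add_pow_le_det {n : ℕ} (hn : 0 < n) {B : Matrix (Fin n) (Fin n) ℂ} (hB : B.PosSemidef)
    {c : ℝ} (hc : 0 ≤ c) :
    B.det + ((c ^ n : ℝ) : ℂ) ≤ (B + (c : ℂ) • (1 : Matrix (Fin n) (Fin n) ℂ)).det := by
  rw [det_add_smul_one hB.1, hB.1.det_eq_prod_eigenvalues]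
  have h : ∏ i, hB.1.eigenvalues i + ∏ _i : Fin n, c ≤ ∏ i, (hB.1.eigenvalues i + c) :=
    Finset.prod_add_prod_le (Finset.mem_univ (⟨0, hn⟩ : Fin n)) le_rfl
      (fun j _ _ => le_add_of_nonneg_right hc)
      (fun j _ _ => le_add_of_nonneg_left (hB.eigenvalues_nonneg j))
      (fun i _ => hB.eigenvalues_nonneg i) (fun i _ => hc)
  rw [Finset.prod_const, Finset.card_univ, Fintype.card_fin] at h
  have h' := Complex.real_le_real.2 h
  simpa using h'

open scoped MatrixOrder in
lemma det_le_det_of_posDef {n : ℕ} {A C : Matrix (Fin n) (Fin n) ℂ} (hC : C.PosDef)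
    (hAC : (A - C).PosSemidef) : C.det ≤ A.det := by
  rcases Nat.eq_zero_or_pos n with rfl | hn
  · simp
  set S := CFC.sqrt C with hS
  have hSS : S * S = C := CFC.sqrt_mul_sqrt_self C hC.posSemidef.nonneg
  have hSp : S.PosSemidef := Matrix.nonneg_iff_posSemidef.1 (CFC.sqrt_nonneg C)
  have hdet : IsUnit S.det := by
    have h := hC.det_pos.ne'
    rw [← hSS, Matrix.det_mul] at h
    exact isUnit_iff_ne_zero.2 (left_ne_zero_of_mul h)
  have hI : (S⁻¹).IsHermitian := hSp.1.inv
  have hD : (S⁻¹ * (A - C) * S⁻¹).PosSemidef := by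
    have := hAC.mul_mul_conjTranspose_same S⁻¹
    rwa [hI.eq] at this
  have hA : A = S * (S⁻¹ * (A - C) * S⁻¹ + ((1 : ℝ) : ℂ) • 1) * S := by
    rw [Complex.ofReal_one, one_smul, mul_add, add_mul, mul_one, hSS,
      show S * (S⁻¹ * (A - C) * S⁻¹) * S = (S * S⁻¹) * (A - C) * (S⁻¹ * S) by noncomm_ring,
      Matrix.mul_nonsing_inv _ hdet, Matrix.nonsing_inv_mul _ hdet]
    simp
  have h1 := det_add_pow_le_det hn hD zero_le_one
  have h2 : (1 : ℂ) ≤ (S⁻¹ * (A - C) * S⁻¹ + ((1 : ℝ) : ℂ) • 1).det := by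
    refine le_trans ?_ h1
    simpa using hD.det_nonneg
  rw [hA, Matrix.det_mul, Matrix.det_mul, mul_right_comm, ← Matrix.det_mul, hSS]
  simpa using mul_le_mul_of_nonneg_left h2 hC.det_pos.le

/-- At a local maximum the second derivative is nonpositive. -/
lemma IsLocalMax.fderiv_fderiv_apply_nonpos {E : Type*} [NormedAddCommGroup E] [NormedSpace ℝ E]
    {F : E → ℝ} {z : E} (hmax : IsLocalMax F z) (hd : ∀ᶠ y in nhds z, DifferentiableAt ℝ F y)
    (hdd : DifferentiableAt ℝ (fderiv ℝ F) z) (h : E) : fderiv ℝ (fderiv ℝ F) z h h ≤ 0 := by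
  by_contra! hpos
  set γ : ℝ → E := fun t => z + t • h with hγ
  have hγ0 : γ 0 = z := by simp [hγ]
  have hγd (t : ℝ) : HasDerivAt γ h t := by
    simpa [hγ] using ((hasDerivAt_id t).smul_const h).const_add z
  have hγc : Filter.Tendsto γ (nhds 0) (nhds z) := by
    have := (hγd 0).continuousAt.tendsto
    rwa [hγ0] at this
  have hφ : ∀ᶠ t in nhds (0 : ℝ), HasDerivAt (F ∘ γ) (fderiv ℝ F (γ t) h) t :=
    (hγc.eventually hd).mono fun t ht => ht.hasFDerivAt.comp_hasDerivAt t (hγd t)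
  have hφ' : deriv (F ∘ γ) =ᶠ[nhds 0] fun t => fderiv ℝ F (γ t) h := hφ.mono fun t ht => ht.deriv
  have hφ'' : HasDerivAt (fun t => fderiv ℝ F (γ t) h) (fderiv ℝ (fderiv ℝ F) z h h) 0 := by
    have h1 : HasFDerivAt (fderiv ℝ F) (fderiv ℝ (fderiv ℝ F) z) (γ 0) := by
      rw [hγ0]; exact hdd.hasFDerivAt
    have h2 := h1.comp_hasDerivAt 0 (hγd 0)
    simpa using h2.clm_apply (hasDerivAt_const (0 : ℝ) h)
  have hdder : deriv (deriv (F ∘ γ)) 0 = fderiv ℝ (fderiv ℝ F) z h h := by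
    rw [hφ'.deriv_eq, hφ''.deriv]
  have hlmax : IsLocalMax (F ∘ γ) 0 := by
    have := hγc.eventually hmax
    simpa [IsLocalMax, IsMaxFilter, hγ0] using this
  have hlmin : IsLocalMin (F ∘ γ) 0 :=
    isLocalMin_of_deriv_deriv_pos (hdder ▸ hpos) hlmax.deriv_eq_zero hφ.self_of_nhds.continuousAt
  have hconst : F ∘ γ =ᶠ[nhds 0] fun _ => (F ∘ γ) 0 := by
    filter_upwards [hlmax, hlmin] with t h1 h2 using le_antisymm h1 h2
  have h1 : deriv (F ∘ γ) =ᶠ[nhds 0] fun _ => (0 : ℝ) :=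
    hconst.deriv.trans (by simp)
  have h2 := h1.deriv_eq
  simp only [deriv_const] at h2
  linarith

open Measure Module in
/-- A locally Lipschitz map between spaces of the same dimension maps null sets to null sets. -/
lemma addHaar_image_eq_zero_of_locallyLipschitz {E F : Type*}
    [NormedAddCommGroup E] [NormedSpace ℝ E] [FiniteDimensional ℝ E]
    [MeasurableSpace E] [BorelSpace E]
    [NormedAddCommGroup F] [NormedSpace ℝ F] [FiniteDimensional ℝ F]
    [MeasurableSpace F] [BorelSpace F] (hEF : finrank ℝ E = finrank ℝ F)
    (μ : Measure E) [μ.IsAddHaarMeasure] {G : E → F} {N : Set E} (hN : μ N = 0)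
    (hG : ∀ z ∈ N, ∃ t ∈ nhds z, ∃ K : NNReal, LipschitzOnWith K G t) :
    (μH[finrank ℝ F] : Measure F) (G '' N) = 0 := by
  have hN' : (μH[finrank ℝ E] : Measure E) N = 0 :=
    absolutelyContinuous_isAddHaarMeasure _ μ hN
  have hchoice : ∀ z : E, ∃ t ∈ nhds z, z ∈ N → ∃ K : NNReal, LipschitzOnWith K G t := fun z => by
    by_cases hz : z ∈ N
    · obtain ⟨t, ht, hK⟩ := hG z hz
      exact ⟨t, ht, fun _ => hK⟩
    · exact ⟨Set.univ, Filter.univ_mem, fun h => absurd h hz⟩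
  choose t ht hK using hchoice
  obtain ⟨s, hsN, hs, hcover⟩ := TopologicalSpace.countable_cover_nhdsWithin
    (f := t) (s := N) fun z _ => mem_nhdsWithin_of_mem_nhds (ht z)
  have hsub : G '' N ⊆ ⋃ z ∈ s, G '' (N ∩ t z) := by
    rintro _ ⟨y, hy, rfl⟩
    obtain ⟨z, hz, hyz⟩ := Set.mem_iUnion₂.1 (hcover hy)
    exact Set.mem_iUnion₂.2 ⟨z, hz, y, ⟨hy, hyz⟩, rfl⟩
  refine measure_mono_null hsub ((measure_biUnion_null_iff hs).2 fun z hz => ?_)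
  obtain ⟨K, hLip⟩ := hK z (hsN hz)
  have h := (hLip.mono Set.inter_subset_right).hausdorffMeasure_image_le
    (s := N ∩ t z) (d := finrank ℝ E) (by positivity)
  rw [measure_mono_null Set.inter_subset_left hN', mul_zero, nonpos_iff_eq_zero] at h
  rwa [← hEF]

lemma euclidean_eq_sum_single {n : ℕ} (b : Cn n) :
    b = ∑ i, ((b i).re • (EuclideanSpace.single i 1 : Cn n)
      + (b i).im • (EuclideanSpace.single i Complex.I : Cn n)) := by
  ext j
  simp [Finset.sum_add_distrib, Pi.single_apply]

lemma I_smul_eq_sum_single {n : ℕ} (b : Cn n) :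
    Complex.I • b = ∑ i, ((b i).re • (EuclideanSpace.single i Complex.I : Cn n)
      - (b i).im • (EuclideanSpace.single i 1 : Cn n)) := by
  ext j
  simp [Pi.single_apply, Finset.sum_sub_distrib]
  apply Complex.ext <;> simp

/-- The Hermitian form of the complex Hessian in terms of real second derivatives. -/
lemma re_star_dotProduct_complexHessian_mulVec {n : ℕ} (u : Cn n → ℝ) (z : Cn n)
    (a : Fin n → ℂ) :
    (star a ⬝ᵥ (complexHessian u z).mulVec a).re =
      (1 / 4) * (D2 u z (WithLp.toLp 2 (star a)) (WithLp.toLp 2 (star a))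
        + D2 u z (Complex.I • WithLp.toLp 2 (star a)) (Complex.I • WithLp.toLp 2 (star a))) := by
  have hD : ∀ c d : Fin n → Cn n, D2 u z (∑ i, c i) (∑ j, d j) = ∑ i, ∑ j, D2 u z (c i) (d j) :=
    fun c d => by
      simp only [D2, map_sum, sum_apply]
      exact Finset.sum_comm
  have h1 := euclidean_eq_sum_single (WithLp.toLp 2 (star a) : Cn n)
  have h2 := I_smul_eq_sum_single (WithLp.toLp 2 (star a) : Cn n)
  rw [congrArg₂ (D2 u z) h1 h1, congrArg₂ (D2 u z) h2 h2, hD, hD,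
    ← Finset.sum_add_distrib, Finset.mul_sum, dotProduct, Complex.re_sum]
  refine Finset.sum_congr rfl fun i _ => ?_
  rw [← Finset.sum_add_distrib, Finset.mul_sum, Matrix.mulVec, dotProduct, Finset.mul_sum,
    Complex.re_sum]
  refine Finset.sum_congr rfl fun j _ => ?_
  simp [complexHessian, D2]
  ring

lemma fderiv_norm_sq_sub {n : ℕ} (x₀ : Cn n) :
    fderiv ℝ (fun z : Cn n => ‖z - x₀‖ ^ 2) = fun z => 2 • innerSL ℝ (z - x₀) := by
  ext z h
  have := ((hasFDerivAt_id (𝕜 := ℝ) z).sub_const x₀).norm_sq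
  simp only [id] at this
  rw [this.fderiv]
  simp

lemma contDiff_norm_sq_sub {n : ℕ} (x₀ : Cn n) :
    ContDiff ℝ 2 (fun z : Cn n => ‖z - x₀‖ ^ 2) :=
  (contDiff_id.sub contDiff_const).norm_sq ℝ

lemma D2_norm_sq_sub {n : ℕ} (x₀ z h : Cn n) :
    D2 (fun z : Cn n => ‖z - x₀‖ ^ 2) z h h = 2 * ‖h‖ ^ 2 := by
  have : HasFDerivAt (fun z : Cn n => 2 • innerSL ℝ (z - x₀)) (2 • innerSL ℝ) z :=
    ((innerSL ℝ (E := Cn n)).hasFDerivAt.comp z ((hasFDerivAt_id z).sub_const x₀)).const_smul 2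
  rw [D2, fderiv_norm_sq_sub, this.fderiv]
  simp only [nsmul_eq_mul, smul_apply, Nat.cast_ofNat]
  exact congrArg (2 * ·) (real_inner_self_eq_norm_sq h)

/-- Maximum principle of Alexandrov–Bony type: if `w` has a locally Lipschitz gradient, is
nonpositive on the boundary of a ball and positive somewhere inside, then any property holding
almost everywhere holds at some point where `w`, up to a linear term, has a local maximum. -/
lemma exists_isLocalMax_add_linear_of_ae {n : ℕ} {x₀ : Cn n} {r : ℝ} (hr : 0 < r)
    {w : Cn n → ℝ} (hcont : ContinuousOn w (closedBall x₀ r))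
    (hd : DifferentiableOn ℝ w (ball x₀ r))
    (hlip : ∀ z ∈ ball x₀ r, ∃ t ∈ nhds z, ∃ K : NNReal, LipschitzOnWith K (fderiv ℝ w) t)
    (hb : ∀ z ∈ sphere x₀ r, w z ≤ 0) {z₀ : Cn n} (hz₀ : z₀ ∈ ball x₀ r) (hpos : 0 < w z₀)
    {P : Cn n → Prop} (hP : ∀ᵐ z, z ∈ ball x₀ r → P z) :
    ∃ z ∈ ball x₀ r, P z ∧ ∃ p : Cn n →L[ℝ] ℝ, IsLocalMax (fun y => w y + p y) z := by
  by_contra! hcon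
  have hfin : Module.finrank ℝ (Cn n) = Module.finrank ℝ (Cn n →L[ℝ] ℝ) := by
    rw [← (LinearMap.toContinuousLinearMap (𝕜 := ℝ) (E := Cn n) (F' := ℝ)).finrank_eq]
    simp
  have : (volume : Measure (Cn n)).IsAddHaarMeasure :=
    inferInstanceAs (Measure.addHaar : Measure (Cn n)).IsAddHaarMeasure
  have hnull := addHaar_image_eq_zero_of_locallyLipschitz hfin volume (G := fderiv ℝ w)
    (N := {z | ¬ (z ∈ ball x₀ r → P z)}) hP fun z hz => by
      simp only [mem_ofPred_eq, Classical.not_imp] at hz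
      exact hlip z hz.1
  have hρ : 0 < w z₀ / (2 * r) := by positivity
  refine (measure_ball_pos (Measure.hausdorffMeasure (Module.finrank ℝ (Cn n →L[ℝ] ℝ)))
    (0 : Cn n →L[ℝ] ℝ) hρ).ne' (measure_mono_null ?_ hnull)
  intro q hq
  obtain ⟨z, hz, hmax⟩ := (isCompact_closedBall x₀ r).exists_isMaxOn
    ⟨z₀, ball_subset_closedBall hz₀⟩ (hcont.sub q.continuous.continuousOn)
  have hzb : z ∈ ball x₀ r := by
    by_contra hzb
    have hzs : z ∈ sphere x₀ r := by
      simp only [mem_closedBall, mem_ball, not_lt, mem_sphere] at *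
      exact le_antisymm hz hzb
    have h1 : w z₀ - q z₀ ≤ w z - q z := hmax (ball_subset_closedBall hz₀)
    have h2 : |q (z₀ - z)| ≤ ‖q‖ * ‖z₀ - z‖ := q.le_opNorm _
    have h3 : ‖z₀ - z‖ ≤ 2 * r := by
      rw [← dist_eq_norm]
      linarith [dist_triangle_right z₀ z x₀, mem_ball.1 hz₀, mem_closedBall.1 hz]
    have h4 : ‖q‖ < w z₀ / (2 * r) := by simpa using hq
    have h5 : ‖q‖ * (2 * r) < w z₀ := (lt_div_iff₀ (by positivity)).1 h4
    have h6 := mul_le_mul_of_nonneg_left h3 (norm_nonneg q)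
    rw [map_sub] at h2
    linarith [hb z hzs, le_abs_self (q z₀ - q z)]
  have hloc : IsLocalMax (fun y => w y + (-q) y) z := by
    have := hmax.isLocalMax (Filter.mem_of_superset (isOpen_ball.mem_nhds hzb)
      ball_subset_closedBall)
    exact this
  refine ⟨z, ?_, ?_⟩
  · simp only [mem_ofPred_eq, Classical.not_imp]
    exact ⟨hzb, fun hPz => hcon z hzb hPz _ hloc⟩
  · have hwz := (hd.differentiableAt (isOpen_ball.mem_nhds hzb)).hasFDerivAt
    have h := hloc.hasFDerivAt_eq_zero (hwz.add (-q).hasFDerivAt)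
    rwa [add_neg_eq_zero] at h

/-- If the real Hessian of `v - u` is at most `-2c`, the complex Hessians differ by at least `c`. -/
lemma posSemidef_complexHessian_sub {n : ℕ} {u v : Cn n → ℝ} {z : Cn n} {c : ℝ}
    (hu : (complexHessian u z).IsHermitian) (hv : (complexHessian v z).IsHermitian)
    (h : ∀ b, D2 v z b b + c * (2 * ‖b‖ ^ 2) - D2 u z b b ≤ 0) :
    (complexHessian u z - (complexHessian v z + (c : ℂ) • 1)).PosSemidef := by
  have hH : (complexHessian u z - (complexHessian v z + (c : ℂ) • 1)).IsHermitian := by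
    refine hu.sub (hv.add ?_)
    simp [Matrix.IsHermitian, Matrix.conjTranspose_smul]
  refine .of_dotProduct_mulVec_nonneg hH fun a => ?_
  rw [Complex.nonneg_iff]
  refine ⟨?_, (hH.im_star_dotProduct_mulVec_self a).symm⟩
  set b : Cn n := WithLp.toLp 2 (star a) with hb
  have hnorm : (star a ⬝ᵥ a).re = ‖b‖ ^ 2 := by
    rw [EuclideanSpace.norm_sq_eq, dotProduct, Complex.re_sum]
    refine Finset.sum_congr rfl fun i _ => ?_
    simp [hb, Complex.sq_norm, Complex.normSq_apply]
  rw [Matrix.sub_mulVec, Matrix.add_mulVec, Matrix.smul_mulVec, Matrix.one_mulVec,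
    dotProduct_sub, dotProduct_add, dotProduct_smul, Complex.sub_re, Complex.add_re,
    smul_eq_mul, Complex.re_ofReal_mul, hnorm, re_star_dotProduct_complexHessian_mulVec,
    re_star_dotProduct_complexHessian_mulVec]
  have h1 := h b
  have h2 := h (Complex.I • b)
  rw [norm_smul, Complex.norm_I, one_mul] at h2
  linarith

/-- The gradient of `u` is Lipschitz near every point of `Ω`. -/
lemma C11On.exists_lipschitzOnWith {n : ℕ} {u : Cn n → ℝ} {Ω : Set (Cn n)} (hu : C11On u Ω)
    {z : Cn n} (hz : z ∈ Ω) :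
    ∃ t ∈ nhds z, ∃ K : NNReal, LipschitzOnWith K (fderiv ℝ u) t := by
  obtain ⟨ε, hε, K, -, hK⟩ := hu.2 z hz
  exact ⟨_, ball_mem_nhds z hε, K, hK⟩

lemma C11On.mono {n : ℕ} {u : Cn n → ℝ} {Ω Ω' : Set (Cn n)} (hu : C11On u Ω) (hΩ' : IsOpen Ω')
    (h : Ω' ⊆ Ω) : C11On u Ω' := by
  refine ⟨hu.1.mono h, fun z hz => ?_⟩
  obtain ⟨ε, hε, K, -, hK⟩ := hu.2 z (h hz)
  obtain ⟨δ, hδ, hsub⟩ := Metric.isOpen_iff.1 hΩ' z hz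
  exact ⟨min ε δ, lt_min hε hδ, K, (ball_subset_ball (min_le_right _ _)).trans hsub,
    hK.mono (ball_subset_ball (min_le_left _ _))⟩

/-- Comparison principle: if `det (v_{i j̄}) ≥ det (u_{i j̄}) - ω` in the ball of radius `r` and
`v ≤ u` on the boundary, then `v - u ≤ r² ω^{1/n}`. -/
lemma sub_le_of_det_complexHessian_le {n : ℕ} (hn : 0 < n) {x₀ : Cn n} {r : ℝ} (hr : 0 < r)
    {u v fu fv : Cn n → ℝ} {ω : ℝ} (hω : 0 ≤ ω)
    (hu11 : C11On u (ball x₀ r)) (huae : AESecondDiff u (ball x₀ r))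
    (hupsh : PshAE u (ball x₀ r)) (hucont : ContinuousOn u (closedBall x₀ r))
    (hdetu : ∀ᵐ z, z ∈ ball x₀ r → (complexHessian u z).det = (fu z : ℂ))
    (hv11 : C11On v (ball x₀ r)) (hvae : AESecondDiff v (ball x₀ r))
    (hvpsh : PshAE v (ball x₀ r)) (hvcont : ContinuousOn v (closedBall x₀ r))
    (hdetv : ∀ᵐ z, z ∈ ball x₀ r → (complexHessian v z).det = (fv z : ℂ))
    (hf : ∀ z ∈ ball x₀ r, fu z ≤ fv z + ω) (hb : ∀ z ∈ sphere x₀ r, v z ≤ u z) :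
    ∀ z ∈ ball x₀ r, v z - u z ≤ r ^ 2 * ω ^ ((1 : ℝ) / n) := by
  intro z₀ hz₀
  by_contra! hcon
  obtain ⟨c, hωc, hc⟩ := exists_between ((lt_div_iff₀' (by positivity)).2 hcon)
  rw [lt_div_iff₀' (by positivity)] at hc
  have hc0 : 0 < c := (Real.rpow_nonneg hω _).trans_lt hωc
  have hcn : ω < c ^ n := by
    have h := pow_lt_pow_left₀ hωc (Real.rpow_nonneg hω _) hn.ne'
    rwa [one_div, Real.rpow_inv_natCast_pow hω hn.ne'] at h
  set Q : Cn n → ℝ := fun z => ‖z - x₀‖ ^ 2 with hQ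
  have hQd : ContDiff ℝ 2 Q := contDiff_norm_sq_sub x₀
  have hQ1 : Differentiable ℝ Q := hQd.differentiable (by norm_num)
  have hQ2 : ContDiff ℝ 1 (fderiv ℝ Q) := hQd.fderiv_right (by norm_num)
  have hud : ∀ y ∈ ball x₀ r, DifferentiableAt ℝ u y := fun y hy =>
    (hu11.1.differentiableOn (by norm_num)).differentiableAt (isOpen_ball.mem_nhds hy)
  have hvd : ∀ y ∈ ball x₀ r, DifferentiableAt ℝ v y := fun y hy =>
    (hv11.1.differentiableOn (by norm_num)).differentiableAt (isOpen_ball.mem_nhds hy)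
  set w : Cn n → ℝ := fun z => v z + c * (Q z - r ^ 2) - u z with hw
  have hwd : ∀ y ∈ ball x₀ r,
      HasFDerivAt w (fderiv ℝ v y + c • fderiv ℝ Q y - fderiv ℝ u y) y := fun y hy =>
    ((hvd y hy).hasFDerivAt.add (((hQ1 y).hasFDerivAt.sub_const (r ^ 2)).const_mul c)).sub
      (hud y hy).hasFDerivAt
  have hlip : ∀ z ∈ ball x₀ r,
      ∃ t ∈ nhds z, ∃ K : NNReal, LipschitzOnWith K (fderiv ℝ w) t := by
    intro z hz
    obtain ⟨t₁, ht₁, K₁, h₁⟩ := hv11.exists_lipschitzOnWith hz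
    obtain ⟨t₂, ht₂, K₂, h₂⟩ := hu11.exists_lipschitzOnWith hz
    obtain ⟨K₃, t₃, ht₃, h₃⟩ := (hQ2.const_smul c).contDiffAt (x := z).exists_lipschitzOnWith
    refine ⟨t₁ ∩ t₃ ∩ t₂ ∩ ball x₀ r, Filter.inter_mem (Filter.inter_mem
      (Filter.inter_mem ht₁ ht₃) ht₂) (isOpen_ball.mem_nhds hz), K₁ + K₃ + K₂, ?_⟩
    have h := (((h₁.mono (inter_subset_left.trans (inter_subset_left.trans inter_subset_left))).add
      (h₃.mono (inter_subset_left.trans (inter_subset_left.trans inter_subset_right)))).sub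
      (h₂.mono (inter_subset_left.trans inter_subset_right)) :
      LipschitzOnWith (K₁ + K₃ + K₂) _ (t₁ ∩ t₃ ∩ t₂ ∩ ball x₀ r))
    intro x hx y hy
    rw [(hwd x hx.2).fderiv, (hwd y hy.2).fderiv]
    exact h hx hy
  have hwb : ∀ z ∈ sphere x₀ r, w z ≤ 0 := fun z hz => by
    have h1 : ‖z - x₀‖ = r := by simpa [dist_eq_norm] using hz
    simp only [hw, hQ, h1]
    linarith [hb z hz]
  have hwpos : 0 < w z₀ := by
    have : 0 ≤ c * Q z₀ := by positivity
    simp only [hw]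
    linarith
  have hP : ∀ᵐ z, z ∈ ball x₀ r → (DifferentiableAt ℝ (fderiv ℝ u) z ∧
      DifferentiableAt ℝ (fderiv ℝ v) z) ∧ ((complexHessian u z).PosSemidef ∧
      (complexHessian v z).PosSemidef) ∧ (complexHessian u z).det = (fu z : ℂ) ∧
      (complexHessian v z).det = (fv z : ℂ) := by
    filter_upwards [huae, hvae, hupsh, hvpsh, hdetu, hdetv] with z h1 h2 h3 h4 h5 h6 hz
    exact ⟨⟨h1 hz, h2 hz⟩, ⟨h3 hz, h4 hz⟩, h5 hz, h6 hz⟩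
  obtain ⟨z, hz, ⟨⟨hu2, hv2⟩, ⟨hup, hvp⟩, hdu, hdv⟩, p, hmax⟩ :=
    exists_isLocalMax_add_linear_of_ae hr (w := w)
      ((hvcont.add (by fun_prop)).sub hucont)
      (fun y hy => (hwd y hy).differentiableAt.differentiableWithinAt) hlip hwb hz₀ hwpos hP
  have hball : ∀ᶠ y in nhds z, y ∈ ball x₀ r := isOpen_ball.mem_nhds hz
  have hF : ∀ y ∈ ball x₀ r, HasFDerivAt (fun y => w y + p y)
      (fderiv ℝ v y + c • fderiv ℝ Q y - fderiv ℝ u y + p) y := fun y hy =>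
    (hwd y hy).add p.hasFDerivAt
  have hF' : fderiv ℝ (fun y => w y + p y) =ᶠ[nhds z]
      fun y => fderiv ℝ v y + c • fderiv ℝ Q y - fderiv ℝ u y + p :=
    hball.mono fun y hy => (hF y hy).fderiv
  have hF'' : HasFDerivAt (fun y => fderiv ℝ v y + c • fderiv ℝ Q y - fderiv ℝ u y + p)
      (fderiv ℝ (fderiv ℝ v) z + c • fderiv ℝ (fderiv ℝ Q) z - fderiv ℝ (fderiv ℝ u) z) z :=
    ((hv2.hasFDerivAt.add ((hQ2.differentiable (by norm_num) z).hasFDerivAt.const_smul c)).sub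
      hu2.hasFDerivAt).add_const p
  have hneg : ∀ b, D2 v z b b + c * (2 * ‖b‖ ^ 2) - D2 u z b b ≤ 0 := fun b => by
    have h := hmax.fderiv_fderiv_apply_nonpos (hball.mono fun y hy => (hF y hy).differentiableAt)
      (hF''.congr_of_eventuallyEq hF').differentiableAt b
    rw [hF'.fderiv_eq, hF''.fderiv] at h
    rw [← D2_norm_sq_sub x₀ z b]
    exact h
  have hle := det_le_det_of_posDef
    (Matrix.PosDef.posSemidef_add hvp (Matrix.PosDef.one.smul (Complex.zero_lt_real.2 hc0)))
    (posSemidef_complexHessian_sub hup.1 hvp.1 hneg)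
  have hle' := (det_add_pow_le_det hn hvp hc0.le).trans hle
  rw [hdu, hdv, ← Complex.ofReal_add, Complex.real_le_real] at hle'
  linarith [hf z hz]

/-- **Comparison of a solution with the solution of the constant coefficient problem.**
Let `B = B(x₀, r) ⊆ ℂⁿ`, let `u` be plurisubharmonic of class `C^{1,1}` on a
neighborhood `U` of the closure of `B` with `det(u_{i j̄}) = f ≥ 0` a.e., and let `v`
be plurisubharmonic of class `C^{1,1}` on `B`, continuous on its closure, with
`det(v_{i j̄}) = f(x₀)` a.e. in `B` and `v = u` on `∂B`. If `ω` bounds the oscillation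
of `f` over `B`, then `sup_B |u − v| ≤ r²·ω^{1/n}`. In particular if `f` is `α`-Hölder
continuous with constant `L`, then `sup_B |u − v| ≤ L^{1/n}·r^{2+α/n}`. -/
theorem comparison_with_constant_MongeAmpere
    {n : ℕ} (hn : 0 < n) (x₀ : Cn n) (r : ℝ) (hr : 0 < r)
    (U : Set (Cn n)) (hU : IsOpen U) (hUcl : closedBall x₀ r ⊆ U)
    (u v f : Cn n → ℝ) (ω : ℝ) (hω : 0 ≤ ω)
    (hu11 : C11On u U) (huae : AESecondDiff u U) (hupsh : PshAE u U)
    (hdetu : ∀ᵐ z, z ∈ U → (complexHessian u z).det = (f z : ℂ))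
    (hf0 : ∀ z ∈ ball x₀ r, 0 ≤ f z)
    (hv11 : C11On v (ball x₀ r)) (hvae : AESecondDiff v (ball x₀ r))
    (hvpsh : PshAE v (ball x₀ r))
    (hvcont : ContinuousOn v (closedBall x₀ r))
    (hdetv : ∀ᵐ z, z ∈ ball x₀ r → (complexHessian v z).det = (f x₀ : ℂ))
    (hbdry : ∀ z ∈ sphere x₀ r, v z = u z)
    (hosc : ∀ x ∈ ball x₀ r, ∀ y ∈ ball x₀ r, f x - f y ≤ ω) :
    (∀ z ∈ ball x₀ r, |u z - v z| ≤ r ^ 2 * ω ^ ((1 : ℝ) / n)) ∧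
      ∀ L α : ℝ, 0 ≤ L → 0 < α → α ≤ 1 →
        (∀ x ∈ ball x₀ r, ∀ y ∈ ball x₀ r, |f x - f y| ≤ L * dist x y ^ α) →
        ∀ z ∈ ball x₀ r, |u z - v z| ≤ L ^ ((1 : ℝ) / n) * r ^ (2 + α / n) := by
  have hx₀ : x₀ ∈ ball x₀ r := mem_ball_self hr
  have hBU : ball x₀ r ⊆ U := ball_subset_closedBall.trans hUcl
  have hu11' := hu11.mono isOpen_ball hBU
  have huae' : AESecondDiff u (ball x₀ r) := huae.mono fun z h hz => h (hBU hz)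
  have hupsh' : PshAE u (ball x₀ r) := hupsh.mono fun z h hz => h (hBU hz)
  have hdetu' : ∀ᵐ z, z ∈ ball x₀ r → (complexHessian u z).det = (f z : ℂ) :=
    hdetu.mono fun z h hz => h (hBU hz)
  have hucont : ContinuousOn u (closedBall x₀ r) := hu11.1.continuousOn.mono hUcl
  have key : ∀ δ : ℝ, 0 ≤ δ → (∀ z ∈ ball x₀ r, |f z - f x₀| ≤ δ) →
      ∀ z ∈ ball x₀ r, |u z - v z| ≤ r ^ 2 * δ ^ ((1 : ℝ) / n) := fun δ hδ hf z hz => by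
    have h1 := sub_le_of_det_complexHessian_le hn hr hδ hu11' huae' hupsh' hucont hdetu'
      hv11 hvae hvpsh hvcont hdetv (fun y hy => by linarith [(abs_le.1 (hf y hy)).2])
      (fun y hy => (hbdry y hy).le) z hz
    have h2 := sub_le_of_det_complexHessian_le hn hr hδ hv11 hvae hvpsh hvcont hdetv
      hu11' huae' hupsh' hucont hdetu' (fun y hy => by linarith [(abs_le.1 (hf y hy)).1])
      (fun y hy => (hbdry y hy).ge) z hz
    exact abs_le.2 ⟨by linarith, h2⟩
  refine ⟨key ω hω fun z hz => abs_le.2 ⟨?_, hosc z hz x₀ hx₀⟩, fun L α hL hα _ hH z hz => ?_⟩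
  · linarith [hosc x₀ hx₀ z hz]
  · have h := key (L * r ^ α) (by positivity) (fun y hy => (hH y hy x₀ hx₀).trans
      (mul_le_mul_of_nonneg_left
        (Real.rpow_le_rpow dist_nonneg (mem_ball.1 hy).le hα.le) hL)) z hz
    refine h.trans_eq ?_
    rw [Real.mul_rpow hL (by positivity), ← Real.rpow_mul hr.le, mul_one_div, Real.rpow_add hr,
      Real.rpow_two]
    ring
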